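/- With notation as in the context, for every $n \geq 2$: (i) for each $1 \leq i \leq n-1$, the function $I_n$, regarded as a rational function in the single variable $z_i$ over the field generated by the remaining variables, has no pole at $z_i = 0$ and its value at $z_i = 0$ equals $0$; (ii) for each $2 \leq i \leq n$, the rational function in $w$ obtained from $I_n$ by substituting $z_i = w^{-1}$ has no pole at $w = 0$ and its value at $w = 0$ equals $0$. (This is the claim in the proof of Lemma 3.3 that all residues of $I_n$ at $0$ and $\infty$ vanish, except the ones in equations (3.21)-(3.22).) -/

import Mathlib

open scoped BigOperators

noncomputable section

/-- `ζ(w) = (1 - w q₁)(1 - w q₂) / ((1 - w)(1 - w q₁ q₂))`. -/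
def zetaF {L : Type*} [Field L] (q₁ q₂ w : L) : L :=
  ((1 - w * q₁) * (1 - w * q₂)) / ((1 - w) * (1 - w * (q₁ * q₂)))

/-- The rational expression `I_n` of equation (3.17) of the paper, evaluated at
`z_1 = z 0, …, z_n = z (n-1)`, where `ι : F →+* L` embeds the field of constants. -/
def Ifun {F L : Type*} [Field F] [Field L] (ι : F →+* L) (q₁ q₂ m : F)
    (r : ℕ) (x x' : Fin r → F) (n : ℕ) (z : ℕ → L) : L :=
  ((∏ i ∈ Finset.range (n - 1), (1 - ι q₁ * ι q₂ * z (i + 1) / z i)) *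
      ∏ i ∈ Finset.range n, ∏ j ∈ Finset.Ico (i + 1) n, zetaF (ι q₁) (ι q₂) (z j / z i))⁻¹ *
    ∏ i ∈ Finset.range n,
      (∏ a : Fin r, (1 - ι m * ι (x a) / (z i * (ι q₁ * ι q₂)))) /
        ∏ a : Fin r, (1 - ι (x' a) / z i)

/-- The rational function `f` has no pole at `0` and its value there is `c`. -/
def RegularAtZero {K : Type*} [Field K] (f : RatFunc K) (c : K) : Prop :=
  ∃ p q : Polynomial K, q.eval 0 ≠ 0 ∧ p.eval 0 = c * q.eval 0 ∧
    f = algebraMap _ (RatFunc K) p / algebraMap _ (RatFunc K) q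

namespace RegularAtZero

variable {K : Type*} [Field K] {f g : RatFunc K} {c d : K}

theorem algebraMap_ne_zero {q : Polynomial K} (hq : q.eval 0 ≠ 0) :
    algebraMap _ (RatFunc K) q ≠ 0 := by
  refine RatFunc.algebraMap_ne_zero ?_
  rintro rfl
  simp at hq

theorem const (a : K) : RegularAtZero (RatFunc.C a) a :=
  ⟨Polynomial.C a, 1, by simp, by simp, by simp⟩

theorem one : RegularAtZero (1 : RatFunc K) 1 := by
  simpa using const (1 : K)

theorem X : RegularAtZero (RatFunc.X : RatFunc K) 0 :=
  ⟨Polynomial.X, 1, by simp, by simp, by simp⟩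

theorem mul (hf : RegularAtZero f c) (hg : RegularAtZero g d) :
    RegularAtZero (f * g) (c * d) := by
  obtain ⟨p, q, hq, hp, rfl⟩ := hf
  obtain ⟨p', q', hq', hp', rfl⟩ := hg
  refine ⟨p * p', q * q', by simp [hq, hq'], ?_, ?_⟩
  · rw [Polynomial.eval_mul, Polynomial.eval_mul, hp, hp']
    ring
  · rw [map_mul, map_mul, div_mul_div_comm]

theorem sub (hf : RegularAtZero f c) (hg : RegularAtZero g d) :
    RegularAtZero (f - g) (c - d) := by
  obtain ⟨p, q, hq, hp, rfl⟩ := hf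
  obtain ⟨p', q', hq', hp', rfl⟩ := hg
  refine ⟨p * q' - q * p', q * q', by simp [hq, hq'], ?_, ?_⟩
  · simp only [Polynomial.eval_mul, Polynomial.eval_sub, hp, hp']
    ring
  · rw [div_sub_div _ _ (algebraMap_ne_zero hq) (algebraMap_ne_zero hq')]
    simp only [map_mul, map_sub]

theorem ne_zero (hf : RegularAtZero f c) (hc : c ≠ 0) : f ≠ 0 := by
  obtain ⟨p, q, hq, hp, rfl⟩ := hf
  refine div_ne_zero (algebraMap_ne_zero ?_) (algebraMap_ne_zero hq)
  rw [hp]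
  exact mul_ne_zero hc hq

theorem inv (hf : RegularAtZero f c) (hc : c ≠ 0) : RegularAtZero f⁻¹ c⁻¹ := by
  obtain ⟨p, q, hq, hp, rfl⟩ := hf
  refine ⟨q, p, ?_, ?_, by rw [inv_div]⟩
  · rw [hp]
    exact mul_ne_zero hc hq
  · rw [hp, inv_mul_cancel_left₀ hc]

theorem div (hf : RegularAtZero f c) (hg : RegularAtZero g d) (hd : d ≠ 0) :
    RegularAtZero (f / g) (c / d) := by
  rw [div_eq_mul_inv, div_eq_mul_inv]
  exact hf.mul (hg.inv hd)

theorem prod {α : Type*} {s : Finset α} {f : α → RatFunc K} {c : α → K}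
    (h : ∀ i ∈ s, RegularAtZero (f i) (c i)) :
    RegularAtZero (∏ i ∈ s, f i) (∏ i ∈ s, c i) := by
  classical
  induction s using Finset.induction_on with
  | empty => simpa using one
  | insert a s ha ih =>
    rw [Finset.prod_insert ha, Finset.prod_insert ha]
    exact (h a (Finset.mem_insert_self a s)).mul
      (ih fun i hi => h i (Finset.mem_insert_of_mem hi))

theorem exists_prod {α : Type*} {s : Finset α} {f : α → RatFunc K}
    (h : ∀ i ∈ s, ∃ c, RegularAtZero (f i) c) :
    ∃ c, RegularAtZero (∏ i ∈ s, f i) c := by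
  choose! c hc using h
  exact ⟨_, prod hc⟩

theorem prod_eq_zero {α : Type*} {s : Finset α} {f : α → RatFunc K}
    (h : ∀ i ∈ s, ∃ c, RegularAtZero (f i) c) {i : α} (hi : i ∈ s)
    (h0 : RegularAtZero (f i) 0) : RegularAtZero (∏ i ∈ s, f i) 0 := by
  classical
  obtain ⟨c, hc⟩ := exists_prod (s := s.erase i) fun j hj => h j (Finset.mem_of_mem_erase hj)
  rw [← Finset.mul_prod_erase s f hi]
  simpa using h0.mul hc

theorem eval_denom_ne_zero (hf : RegularAtZero f c) : f.denom.eval 0 ≠ 0 := by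
  obtain ⟨p, q, hq, -, hpq⟩ := hf
  have hq0 : q ≠ 0 := by
    rintro rfl
    simp at hq
  obtain ⟨t, ht⟩ := (RatFunc.denom_dvd hq0).2 ⟨p, hpq⟩
  intro h
  rw [ht, Polynomial.eval_mul, h, zero_mul] at hq
  exact hq rfl

theorem eval_num_div_eval_denom (hf : RegularAtZero f c) :
    f.num.eval 0 / f.denom.eval 0 = c := by
  have hd := hf.eval_denom_ne_zero
  obtain ⟨p, q, hq, hp, hpq⟩ := hf
  have hq0 : q ≠ 0 := by
    rintro rfl
    simp at hq
  have h := congrArg (Polynomial.eval 0) ((RatFunc.num_mul_eq_mul_denom_iff hq0).2 hpq)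
  rw [Polynomial.eval_mul, Polynomial.eval_mul, hp] at h
  rw [div_eq_iff hd]
  apply mul_right_cancel₀ hq
  rw [h]
  ring

theorem X_sub_const (a : K) : RegularAtZero (RatFunc.X - RatFunc.C a) (-a) := by
  simpa using X.sub (const a)

theorem one_sub_X_mul_const (a : K) : RegularAtZero (1 - RatFunc.X * RatFunc.C a) 1 := by
  simpa using one.sub (X.mul (const a))

theorem one_sub_const_div_X (a : K) :
    1 - RatFunc.C a / RatFunc.X = (RatFunc.X - RatFunc.C a) / RatFunc.X := by
  rw [sub_div, div_self RatFunc.X_ne_zero]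

theorem inv_one_sub_const_div_X {a : K} (ha : a ≠ 0) :
    RegularAtZero (1 - RatFunc.C a / RatFunc.X)⁻¹ 0 := by
  rw [one_sub_const_div_X, inv_div]
  simpa using X.div (X_sub_const a) (neg_ne_zero.2 ha)

theorem one_sub_div_one_sub {a b : K} (hb : b ≠ 0) :
    RegularAtZero ((1 - RatFunc.C a / RatFunc.X) / (1 - RatFunc.C b / RatFunc.X)) (a / b) := by
  rw [one_sub_const_div_X, one_sub_const_div_X, div_div_div_cancel_right₀ RatFunc.X_ne_zero]
  simpa using (X_sub_const a).div (X_sub_const b) (neg_ne_zero.2 hb)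

theorem zetaF_X_mul_const (p q a : K) :
    RegularAtZero (zetaF (RatFunc.C p) (RatFunc.C q) (RatFunc.X * RatFunc.C a)) 1 := by
  have h (b : K) : RegularAtZero (1 - RatFunc.X * RatFunc.C a * RatFunc.C b) 1 := by
    rw [mul_assoc, ← map_mul]
    exact one_sub_X_mul_const _
  unfold zetaF
  rw [← map_mul]
  simpa using ((h p).mul (h q)).div ((one_sub_X_mul_const a).mul (h (p * q))) (by simp)

theorem zetaF_const_div_X {p q a : K} (hp : p ≠ 0) (hq : q ≠ 0) (ha : a ≠ 0) :
    RegularAtZero (zetaF (RatFunc.C p) (RatFunc.C q) (RatFunc.C a / RatFunc.X)) 1 := by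
  have h : zetaF (RatFunc.C p) (RatFunc.C q) (RatFunc.C a / RatFunc.X) =
      (1 - RatFunc.C (a * p) / RatFunc.X) / (1 - RatFunc.C a / RatFunc.X) *
        ((1 - RatFunc.C (a * q) / RatFunc.X) / (1 - RatFunc.C (a * (p * q)) / RatFunc.X)) := by
    unfold zetaF
    rw [div_mul_div_comm]
    simp only [map_mul, mul_div_right_comm]
  rw [h]
  convert (one_sub_div_one_sub (a := a * p) ha).mul
    (one_sub_div_one_sub (a := a * q) (b := a * (p * q)) (by simp [*])) using 1
  field_simp

end RegularAtZero

section Ifun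

variable {F K : Type*} [Field F] [Field K] (ι : F →+* K) {r : ℕ} {q₁ q₂ : F} (m : F)
  (x : Fin r → F) {x' : Fin r → F} {n k : ℕ} {z : ℕ → RatFunc K}

theorem Ifun_regularAtZero
    (hchain : ∀ i < n - 1, ∃ c, RegularAtZero
      (1 - RatFunc.C (ι q₁) * RatFunc.C (ι q₂) * z (i + 1) / z i)⁻¹ c)
    (hk : ∃ i < n - 1, RegularAtZero
      (1 - RatFunc.C (ι q₁) * RatFunc.C (ι q₂) * z (i + 1) / z i)⁻¹ 0)
    (hzeta : ∀ i j, i < j → j < n → ∃ c, RegularAtZero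
      (zetaF (RatFunc.C (ι q₁)) (RatFunc.C (ι q₂)) (z j / z i))⁻¹ c)
    (hfac : ∀ i < n, ∀ a, ∃ c, RegularAtZero
      ((1 - RatFunc.C (ι m) * RatFunc.C (ι (x a)) /
        (z i * (RatFunc.C (ι q₁) * RatFunc.C (ι q₂)))) / (1 - RatFunc.C (ι (x' a)) / z i)) c) :
    RegularAtZero (Ifun (RatFunc.C.comp ι) q₁ q₂ m r x x' n z) 0 := by
  unfold Ifun
  simp only [RingHom.comp_apply, mul_inv, ← Finset.prod_inv_distrib, ← Finset.prod_div_distrib]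
  obtain ⟨i, hi, h0⟩ := hk
  have h1 := RegularAtZero.prod_eq_zero (fun i hi => hchain i (Finset.mem_range.1 hi))
    (Finset.mem_range.2 hi) h0
  obtain ⟨c, h2⟩ := RegularAtZero.exists_prod (s := Finset.range n) fun i _ =>
    RegularAtZero.exists_prod (s := Finset.Ico (i + 1) n) fun j hj =>
      hzeta i j (Finset.mem_Ico.1 hj).1 (Finset.mem_Ico.1 hj).2
  obtain ⟨d, h3⟩ := RegularAtZero.exists_prod (s := Finset.range n) fun i hi =>
    RegularAtZero.exists_prod (s := Finset.univ) fun a _ => hfac i (Finset.mem_range.1 hi) a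
  simpa using (h1.mul h2).mul h3

theorem exists_regularAtZero_inv_zetaF_const (p q a b : K) :
    ∃ c, RegularAtZero
      (zetaF (RatFunc.C p) (RatFunc.C q) (RatFunc.C a / RatFunc.C b))⁻¹ c := by
  rw [← map_div₀]
  refine ⟨(zetaF p q (a / b))⁻¹, ?_⟩
  convert RegularAtZero.const (zetaF p q (a / b))⁻¹ using 1
  simp [zetaF]

theorem exists_regularAtZero_inv_chain_const (p q a b : K) :
    ∃ c, RegularAtZero
      (1 - RatFunc.C p * RatFunc.C q * RatFunc.C a / RatFunc.C b)⁻¹ c := by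
  refine ⟨(1 - p * q * a / b)⁻¹, ?_⟩
  convert RegularAtZero.const (1 - p * q * a / b)⁻¹ using 1
  simp

theorem exists_regularAtZero_factor_const (m' y y' p q b : K) :
    ∃ c, RegularAtZero ((1 - RatFunc.C m' * RatFunc.C y /
      (RatFunc.C b * (RatFunc.C p * RatFunc.C q))) / (1 - RatFunc.C y' / RatFunc.C b)) c := by
  refine ⟨(1 - m' * y / (b * (p * q))) / (1 - y' / b), ?_⟩
  convert RegularAtZero.const ((1 - m' * y / (b * (p * q))) / (1 - y' / b)) using 1
  simp

theorem Ifun_regularAtZero_of_eq_X (hq₁ : q₁ ≠ 0) (hq₂ : q₂ ≠ 0) (hx' : ∀ a, x' a ≠ 0)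
    (hk : k < n - 1) (hz : ∀ j < n, j ≠ k → ∃ a, a ≠ 0 ∧ z j = RatFunc.C a)
    (hzk : z k = RatFunc.X) :
    RegularAtZero (Ifun (RatFunc.C.comp ι) q₁ q₂ m r x x' n z) 0 := by
  have h₁ : ι q₁ ≠ 0 := (map_ne_zero ι).2 hq₁
  have h₂ : ι q₂ ≠ 0 := (map_ne_zero ι).2 hq₂
  have h0 : RegularAtZero
      (1 - RatFunc.C (ι q₁) * RatFunc.C (ι q₂) * z (k + 1) / z k)⁻¹ 0 := by
    obtain ⟨a, ha, hza⟩ := hz (k + 1) (by omega) (by omega)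
    rw [hza, hzk, ← map_mul, ← map_mul]
    exact RegularAtZero.inv_one_sub_const_div_X (mul_ne_zero (mul_ne_zero h₁ h₂) ha)
  refine Ifun_regularAtZero ι m x (fun i hi => ?_) ⟨k, hk, h0⟩ (fun i j hij hj => ?_)
    (fun i hi a => ?_)
  · by_cases hik : i = k
    · exact ⟨0, hik ▸ h0⟩
    obtain ⟨b, hb, hzb⟩ := hz i (by omega) hik
    rw [hzb]
    by_cases hik' : i + 1 = k
    · refine ⟨1⁻¹, RegularAtZero.inv ?_ one_ne_zero⟩
      rw [hik', hzk]
      convert RegularAtZero.one_sub_X_mul_const (ι q₁ * ι q₂ / b) using 2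
      simp only [map_div₀, map_mul]
      ring
    · obtain ⟨a, ha, hza⟩ := hz (i + 1) (by omega) hik'
      rw [hza]
      exact exists_regularAtZero_inv_chain_const _ _ _ _
  · by_cases hik : i = k
    · obtain ⟨a, ha, hza⟩ := hz j hj (by omega)
      rw [hik, hza, hzk]
      exact ⟨_, (RegularAtZero.zetaF_const_div_X h₁ h₂ ha).inv one_ne_zero⟩
    obtain ⟨b, hb, hzb⟩ := hz i (by omega) hik
    rw [hzb]
    by_cases hjk : j = k
    · rw [hjk, hzk, div_eq_mul_inv, ← map_inv₀]
      exact ⟨_, (RegularAtZero.zetaF_X_mul_const _ _ _).inv one_ne_zero⟩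
    · obtain ⟨a, ha, hza⟩ := hz j hj hjk
      rw [hza]
      exact exists_regularAtZero_inv_zetaF_const _ _ _ _
  · by_cases hik : i = k
    · rw [hik, hzk, mul_comm RatFunc.X, ← map_mul RatFunc.C, ← map_mul RatFunc.C, ← div_div,
        ← map_div₀]
      exact ⟨_, RegularAtZero.one_sub_div_one_sub ((map_ne_zero ι).2 (hx' a))⟩
    · obtain ⟨b, hb, hzb⟩ := hz i hi hik
      rw [hzb]
      exact exists_regularAtZero_factor_const _ _ _ _ _ _

theorem Ifun_regularAtZero_of_eq_inv_X (hq₁ : q₁ ≠ 0) (hq₂ : q₂ ≠ 0)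
    (hk : 1 ≤ k) (hkn : k < n) (hz : ∀ j < n, j ≠ k → ∃ a, a ≠ 0 ∧ z j = RatFunc.C a)
    (hzk : z k = RatFunc.X⁻¹) :
    RegularAtZero (Ifun (RatFunc.C.comp ι) q₁ q₂ m r x x' n z) 0 := by
  have h₁ : ι q₁ ≠ 0 := (map_ne_zero ι).2 hq₁
  have h₂ : ι q₂ ≠ 0 := (map_ne_zero ι).2 hq₂
  obtain ⟨l, rfl⟩ : ∃ l, k = l + 1 := ⟨k - 1, by omega⟩
  have h0 : RegularAtZero
      (1 - RatFunc.C (ι q₁) * RatFunc.C (ι q₂) * z (l + 1) / z l)⁻¹ 0 := by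
    obtain ⟨b, hb, hzb⟩ := hz l (by omega) (by omega)
    rw [hzk, hzb]
    convert RegularAtZero.inv_one_sub_const_div_X
      (div_ne_zero (mul_ne_zero h₁ h₂) hb) using 3
    simp only [map_div₀, map_mul]
    ring
  refine Ifun_regularAtZero ι m x (fun i hi => ?_) ⟨l, by omega, h0⟩ (fun i j hij hj => ?_)
    (fun i hi a => ?_)
  · by_cases hil : i = l
    · exact ⟨0, hil ▸ h0⟩
    obtain ⟨a, ha, hza⟩ := hz (i + 1) (by omega) (by omega)
    rw [hza]
    by_cases hik : i = l + 1
    · refine ⟨1⁻¹, RegularAtZero.inv ?_ one_ne_zero⟩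
      rw [hik, hzk]
      convert RegularAtZero.one_sub_X_mul_const (ι q₁ * ι q₂ * a) using 2
      rw [div_inv_eq_mul, mul_comm, map_mul, map_mul]
    · obtain ⟨b, hb, hzb⟩ := hz i (by omega) hik
      rw [hzb]
      exact exists_regularAtZero_inv_chain_const _ _ _ _
  · by_cases hik : i = l + 1
    · obtain ⟨a, ha, hza⟩ := hz j hj (by omega)
      rw [hik, hza, hzk, div_inv_eq_mul, mul_comm]
      exact ⟨_, (RegularAtZero.zetaF_X_mul_const _ _ _).inv one_ne_zero⟩
    obtain ⟨b, hb, hzb⟩ := hz i (by omega) hik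
    rw [hzb]
    by_cases hjk : j = l + 1
    · rw [hjk, hzk, div_eq_mul_inv, mul_comm, ← map_inv₀, ← div_eq_mul_inv]
      exact ⟨_, (RegularAtZero.zetaF_const_div_X h₁ h₂ (inv_ne_zero hb)).inv one_ne_zero⟩
    · obtain ⟨a, ha, hza⟩ := hz j hj hjk
      rw [hza]
      exact exists_regularAtZero_inv_zetaF_const _ _ _ _
  · by_cases hik : i = l + 1
    · refine ⟨1 / 1, ?_⟩
      rw [hik, hzk]
      refine RegularAtZero.div ?_ ?_ one_ne_zero
      · convert RegularAtZero.one_sub_X_mul_const (ι m * ι (x a) / (ι q₁ * ι q₂)) using 2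
        simp only [map_mul, map_inv₀, div_eq_mul_inv, mul_inv, inv_inv]
        ring
      · rw [div_inv_eq_mul, mul_comm]
        exact RegularAtZero.one_sub_X_mul_const _
    · obtain ⟨b, hb, hzb⟩ := hz i hi hik
      rw [hzb]
      exact exists_regularAtZero_factor_const _ _ _ _ _ _

end Ifun

theorem algebraMap_fractionRing_X_ne_zero {F σ : Type*} [Field F] (s : σ) :
    algebraMap (MvPolynomial σ F) (FractionRing (MvPolynomial σ F)) (MvPolynomial.X s) ≠ 0 :=
  (map_ne_zero_iff _ (IsFractionRing.injective _ _)).2 (MvPolynomial.X_ne_zero s)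

/-- For `n ≥ 2`:
(i) for each `1 ≤ i ≤ n - 1` (here `i` is the 0-based index `iv`, with `iv < n - 1`,
corresponding to the paper's variable `z_{iv+1}`), the function `I_n`, regarded as a
rational function in the single variable `z_{iv+1}` over the field generated by the
remaining variables, has no pole at `z_{iv+1} = 0` and its value there is `0`;
(ii) for each `2 ≤ i ≤ n` (0-based: `1 ≤ iv < n`), the rational function in `w` obtained
from `I_n` by substituting `z_{iv+1} = w⁻¹` has no pole at `w = 0` and its value there
is `0`. -/
theorem stmt_3 {F : Type} [Field F] (r : ℕ) (hr : 1 ≤ r) (q₁ q₂ m : F)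
    (x x' : Fin r → F) (hq₁ : q₁ ≠ 0) (hq₂ : q₂ ≠ 0) (hm : m ≠ 0)
    (hx : ∀ a, x a ≠ 0) (hx' : ∀ a, x' a ≠ 0) (n : ℕ) (hn : 2 ≤ n) :
    (∀ iv : ℕ, iv < n - 1 →
      let K := FractionRing (MvPolynomial {j : ℕ // j < n ∧ j ≠ iv} F)
      let Z : {j : ℕ // j < n ∧ j ≠ iv} → K := fun s =>
        algebraMap (MvPolynomial {j : ℕ // j < n ∧ j ≠ iv} F) K (MvPolynomial.X s)
      let ιK : F →+* K :=
        (algebraMap (MvPolynomial {j : ℕ // j < n ∧ j ≠ iv} F) K).comp MvPolynomial.C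
      let In : RatFunc K := Ifun ((RatFunc.C).comp ιK) q₁ q₂ m r x x' n
        (fun j => if h : j < n ∧ j ≠ iv then RatFunc.C (Z ⟨j, h⟩) else RatFunc.X)
      Polynomial.eval 0 (RatFunc.denom In) ≠ 0 ∧
        Polynomial.eval 0 (RatFunc.num In) / Polynomial.eval 0 (RatFunc.denom In) = 0) ∧
    (∀ iv : ℕ, 1 ≤ iv → iv < n →
      let K := FractionRing (MvPolynomial {j : ℕ // j < n ∧ j ≠ iv} F)
      let Z : {j : ℕ // j < n ∧ j ≠ iv} → K := fun s =>
        algebraMap (MvPolynomial {j : ℕ // j < n ∧ j ≠ iv} F) K (MvPolynomial.X s)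
      let ιK : F →+* K :=
        (algebraMap (MvPolynomial {j : ℕ // j < n ∧ j ≠ iv} F) K).comp MvPolynomial.C
      let In : RatFunc K := Ifun ((RatFunc.C).comp ιK) q₁ q₂ m r x x' n
        (fun j => if h : j < n ∧ j ≠ iv then RatFunc.C (Z ⟨j, h⟩) else RatFunc.X⁻¹)
      Polynomial.eval 0 (RatFunc.denom In) ≠ 0 ∧
        Polynomial.eval 0 (RatFunc.num In) / Polynomial.eval 0 (RatFunc.denom In) = 0) := by
  refine ⟨fun iv hiv => ?_, fun iv hiv hivn => ?_⟩
  · intro K Z ιK In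
    have h : RegularAtZero In 0 := by
      refine Ifun_regularAtZero_of_eq_X ιK m x hq₁ hq₂ hx' hiv (fun j hj hjk => ?_) ?_
      · exact ⟨Z ⟨j, hj, hjk⟩, algebraMap_fractionRing_X_ne_zero _, dif_pos ⟨hj, hjk⟩⟩
      · exact dif_neg fun h => h.2 rfl
    exact ⟨h.eval_denom_ne_zero, h.eval_num_div_eval_denom⟩
  · intro K Z ιK In
    have h : RegularAtZero In 0 := by
      refine Ifun_regularAtZero_of_eq_inv_X ιK m x hq₁ hq₂ hiv hivn (fun j hj hjk => ?_) ?_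
      · exact ⟨Z ⟨j, hj, hjk⟩, algebraMap_fractionRing_X_ne_zero _, dif_pos ⟨hj, hjk⟩⟩
      · exact dif_neg fun h => h.2 rfl
    exact ⟨h.eval_denom_ne_zero, h.eval_num_div_eval_denom⟩
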